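/- Let (A,B,C) be a triple whose indices α_i, β_j^(μ), γ_l are all distinct and satisfy α_i < α_{i+1}, β_i^0 < β_i^1, β_i^ν < β_{i+1}^ν, β_i^0 < α_1, β_i^1 < α_3, γ_i < γ_{i+1}. Then there exists ε ∈ {+1, −1} such that for all ω ∈ ⋀^p k^n, writing G_{A,B,C}(ω) = Σ_{1≤i<j≤4} Π̂_{ij} e_i∧e_j, one has P'_{A,B,C}(ω) = ε · (Π̂_{12}Π̂_{34} − Π̂_{13}Π̂_{24} + Π̂_{14}Π̂_{23}); i.e. P'_{A,B,C} is, up to sign, the pullback under G_{A,B,C} of the single Plücker relation on ⋀^2 k^4. -/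

import Mathlib

open ExteriorAlgebra

noncomputable section

variable (k : Type*) [Field k]

/-- The alternating map giving the coordinate `Π_idx` (antisymmetric in `idx`). -/
def coordA {n : ℕ} (q : ℕ) (idx : Fin q → Fin n) :
    (Fin n → k) [⋀^Fin q]→ₗ[k] k :=
  (Matrix.detRowAlternating : (Fin q → k) [⋀^Fin q]→ₗ[k] k).compLinearMap
    (LinearMap.funLeft k k idx)

/-- The coordinate functional `Π_idx` on the exterior algebra. -/
def coordF {n : ℕ} (q : ℕ) (idx : Fin q → Fin n) :
    ExteriorAlgebra k (Fin n → k) →ₗ[k] k :=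
  ExteriorAlgebra.liftAlternating
    (Function.update (fun i => (0 : (Fin n → k) [⋀^Fin i]→ₗ[k] k)) q (coordA k q idx))

/-- Decomposability of an element of the exterior algebra, in degree `q`. -/
def IsDecomp {n : ℕ} (q : ℕ) (x : ExteriorAlgebra k (Fin n → k)) : Prop :=
  ∃ v : Fin q → (Fin n → k), x = ExteriorAlgebra.ιMulti k q v

/-- The dual isomorphism `δ` on the degree-`p` part, with values in degree `n-p`. -/
def dualAt (n p : ℕ) (ω : ExteriorAlgebra k (Fin n → k)) :
    ExteriorAlgebra k (Fin n → k) :=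
  ∑ s : {s : Finset (Fin n) // s.card = p},
    coordF k p (fun a => (s.1.orderIsoOfFin s.2 a : Fin n)) ω •
      ExteriorAlgebra.ιMulti k (n - p)
        (fun a => Pi.single (((s.1ᶜ).orderIsoOfFin
          (by rw [Finset.card_compl, s.2, Fintype.card_fin]) a : Fin n)) (1 : k))

/-- The index tuple `(α_i, α_j, β_1^{ε_1}, …, β_m^{ε_m}, γ_1, …, γ_c)`. -/
def tupleP {n : ℕ} (m c : ℕ) (α : Fin 4 → Fin n) (β : Fin m → Fin 2 → Fin n)
    (γ : Fin c → Fin n) (i j : Fin 4) (ε : Fin m → Fin 2) : Fin (2 + (m + c)) → Fin n :=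
  Fin.append ![α i, α j] (Fin.append (fun l => β l (ε l)) γ)

/-- The functional `π_{ij} = Π_{α_i α_j β⃗_1 … β⃗_m γ_1 … γ_c}`. -/
def piF {n : ℕ} (m c : ℕ) (α : Fin 4 → Fin n) (β : Fin m → Fin 2 → Fin n)
    (γ : Fin c → Fin n) (i j : Fin 4) :
    ExteriorAlgebra k (Fin n → k) →ₗ[k] k :=
  ∑ ε : Fin m → Fin 2, coordF k (2 + (m + c)) (tupleP m c α β γ i j ε)

/-- The rank 6 quadratic form `P'_{A,B,C}`. -/
def Pprime {n : ℕ} (m c : ℕ) (α : Fin 4 → Fin n) (β : Fin m → Fin 2 → Fin n)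
    (γ : Fin c → Fin n) (ω : ExteriorAlgebra k (Fin n → k)) : k :=
  piF k m c α β γ 0 1 ω * piF k m c α β γ 2 3 ω
    - piF k m c α β γ 0 2 ω * piF k m c α β γ 1 3 ω
    + piF k m c α β γ 0 3 ω * piF k m c α β γ 1 2 ω

/-- The ordering/distinctness conditions on the triple `(A,B,C)`. -/
def OrderedABC {n : ℕ} (m c : ℕ) (α : Fin 4 → Fin n) (β : Fin m → Fin 2 → Fin n)
    (γ : Fin c → Fin n) : Prop :=
  Function.Injective (Sum.elim α (Sum.elim (fun x : Fin m × Fin 2 => β x.1 x.2) γ)) ∧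
    StrictMono α ∧ (∀ l, β l 0 < β l 1) ∧
    (∀ ν : Fin 2, StrictMono fun l => β l ν) ∧
    (∀ l, β l 0 < α 0) ∧ (∀ l, β l 1 < α 2) ∧ StrictMono γ

/-- The set `S' = A ∪ B_1 ∪ C`. -/
def SP {n : ℕ} (m c : ℕ) (α : Fin 4 → Fin n) (β : Fin m → Fin 2 → Fin n)
    (γ : Fin c → Fin n) : Finset (Fin n) :=
  Finset.univ.image α ∪ Finset.univ.image (fun l => β l 1) ∪ Finset.univ.image γ

open Classical in
/-- The matrix of the map `X_{A,B,C} : k^n → k^{p+2}`. -/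
def Xmat (p : ℕ) {n : ℕ} (m c : ℕ) (α : Fin 4 → Fin n) (β : Fin m → Fin 2 → Fin n)
    (γ : Fin c → Fin n) : Matrix (Fin (p + 2)) (Fin n) k :=
  if h : (SP m c α β γ).card = p + 2 then
    fun j i =>
      (if i = ((SP m c α β γ).orderIsoOfFin h j : Fin n) then 1 else 0) +
        ∑ l : Fin m,
          if i = β l 0 ∧ β l 1 = ((SP m c α β γ).orderIsoOfFin h j : Fin n) then 1 else 0
  else 0

/-- The linear map `X_{A,B,C} : k^n → k^{p+2}`. -/
def XL (p : ℕ) {n : ℕ} (m c : ℕ) (α : Fin 4 → Fin n) (β : Fin m → Fin 2 → Fin n)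
    (γ : Fin c → Fin n) : (Fin n → k) →ₗ[k] (Fin (p + 2) → k) :=
  (Xmat k p m c α β γ).mulVecLin

open Classical in
/-- The matrix of the map `Z : k^{p+2} → k^4`. -/
def Zmat (p : ℕ) {n : ℕ} (m c : ℕ) (α : Fin 4 → Fin n) (β : Fin m → Fin 2 → Fin n)
    (γ : Fin c → Fin n) : Matrix (Fin 4) (Fin (p + 2)) k :=
  fun j i => if XL k p m c α β γ (Pi.single (α j) 1) = Pi.single i 1 then 1 else 0

/-- The linear map `Z : k^{p+2} → k^4`. -/
def ZL (p : ℕ) {n : ℕ} (m c : ℕ) (α : Fin 4 → Fin n) (β : Fin m → Fin 2 → Fin n)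
    (γ : Fin c → Fin n) : (Fin (p + 2) → k) →ₗ[k] (Fin 4 → k) :=
  (Zmat k p m c α β γ).mulVecLin

/-- The Grassmann cone preserving map `G_{A,B,C} = ⋀²Z ∘ δ ∘ ⋀^p X_{A,B,C}`. -/
def GABC (p : ℕ) {n : ℕ} (m c : ℕ) (α : Fin 4 → Fin n) (β : Fin m → Fin 2 → Fin n)
    (γ : Fin c → Fin n) (ω : ExteriorAlgebra k (Fin n → k)) :
    ExteriorAlgebra k (Fin 4 → k) :=
  ExteriorAlgebra.map (ZL k p m c α β γ)
    (dualAt k (p + 2) p (ExteriorAlgebra.map (XL k p m c α β γ) ω))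

/-- The general Plücker quadratic form `P_{A,B}` for index sequences
`a : Fin d → Fin n` and `b : Fin (e+1) → Fin n`. -/
def Pluecker {n : ℕ} (d e : ℕ) (a : Fin d → Fin n) (b : Fin (e + 1) → Fin n)
    (ω : ExteriorAlgebra k (Fin n → k)) : k :=
  ∑ i : Fin (e + 1), (-1 : k) ^ (i : ℕ) *
    (coordF k (d + 1) (Fin.snoc a (b i)) ω * coordF k e (fun j => b (i.succAbove j)) ω)


/-- The increasing enumeration of the complement of `{i, j}`, for `i < j`. -/
def skipPair {q : ℕ} (i j : Fin (q + 2)) (h : i < j) (x : Fin q) : Fin (q + 2) :=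
  i.succAbove ((j.pred (Fin.ne_zero_of_lt h)).succAbove x)

lemma skipPair_val {q : ℕ} (i j : Fin (q + 2)) (h : i < j) (x : Fin q) :
    (skipPair i j h x : ℕ) =
      if (x : ℕ) < i then (x : ℕ) else if (x : ℕ) + 1 < j then x + 1 else x + 2 := by
  have h' : (i : ℕ) < j := h
  simp only [skipPair, Fin.succAbove, Fin.lt_def, Fin.val_castSucc, Fin.val_pred]
  split_ifs <;> simp at * <;> omega

lemma skipPair_strictMono {q : ℕ} (i j : Fin (q + 2)) (h : i < j) :
    StrictMono (skipPair i j h) :=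
  (Fin.strictMono_succAbove _).comp (Fin.strictMono_succAbove _)

lemma skipPair_ne_left {q : ℕ} (i j : Fin (q + 2)) (h : i < j) (x : Fin q) :
    skipPair i j h x ≠ i :=
  Fin.succAbove_ne _ _

lemma skipPair_ne_right {q : ℕ} (i j : Fin (q + 2)) (h : i < j) (x : Fin q) :
    skipPair i j h x ≠ j := by
  have h' : (i : ℕ) < j := h
  rw [Ne, Fin.ext_iff, skipPair_val]
  split_ifs <;> omega

section Determinants

variable {k}

lemma det_cons_single {q : ℕ} (i : Fin (q + 1)) (w : Fin q → Fin (q + 1) → k) :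
    Matrix.det (Matrix.of (Fin.cons (Pi.single i 1) w : Fin (q + 1) → Fin (q + 1) → k)) =
      (-1) ^ (i : ℕ) * Matrix.det (Matrix.of fun a b => w a (i.succAbove b)) := by
  rw [Matrix.det_succ_row_zero, Finset.sum_eq_single i]
  · simp only [Matrix.of_apply, Fin.cons_zero, Pi.single_eq_same, mul_one]
    rfl
  · intro b _ hb
    simp [Pi.single_eq_of_ne hb]
  · simp

lemma det_cons_single_cons_single {q : ℕ} (i j : Fin (q + 2)) (h : i < j)
    (v : Fin q → Fin (q + 2) → k) :
    Matrix.det (Matrix.of (Fin.cons (Pi.single i 1) (Fin.cons (Pi.single j 1) v :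
        Fin (q + 1) → Fin (q + 2) → k) : Fin (q + 2) → Fin (q + 2) → k)) =
      (-1) ^ ((i : ℕ) + j + 1) * Matrix.det (Matrix.of fun a b => v a (skipPair i j h b)) := by
  have h' : (i : ℕ) < j := h
  have hij : i.succAbove (j.pred (Fin.ne_zero_of_lt h)) = j := by
    simp only [Fin.succAbove, Fin.ext_iff, Fin.lt_def, Fin.val_castSucc, Fin.val_pred]
    split_ifs <;> simp
    omega
  rw [det_cons_single]
  have hrow : (fun a b => (Fin.cons (Pi.single j 1) v : Fin (q + 1) → Fin (q + 2) → k) a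
      (i.succAbove b)) =
      Fin.cons (Pi.single (j.pred (Fin.ne_zero_of_lt h)) 1) (fun a b => v a (i.succAbove b)) := by
    funext a b
    refine Fin.cases ?_ (fun a => ?_) a
    · simp only [Fin.cons_zero]
      conv_lhs => rw [← hij]
      simp [Pi.single_apply]
    · simp
  rw [hrow, det_cons_single, ← mul_assoc, ← pow_add, Fin.val_pred]
  have : (i : ℕ) + j + 1 = i + (j - 1) + 2 := by omega
  rw [this, pow_add _ _ 2]
  simp [skipPair]

lemma det_skipPair_perm {q : ℕ} (σ : Equiv.Perm (Fin (q + 2))) (i j : Fin (q + 2)) (h : i < j)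
    (hσ : σ i < σ j) (v : Fin q → Fin (q + 2) → k) :
    Matrix.det (Matrix.of fun a b => v a (σ (skipPair i j h b))) =
      (Equiv.Perm.sign σ : ℤ) * (-1) ^ ((i : ℕ) + j + σ i + σ j) *
        Matrix.det (Matrix.of fun a b => v a (skipPair (σ i) (σ j) hσ b)) := by
  have h1 := det_cons_single_cons_single i j h (fun a b => v a (σ b))
  have h2 := det_cons_single_cons_single (σ i) (σ j) hσ v
  have h3 := Matrix.det_permute' σ (Matrix.of (Fin.cons (Pi.single (σ i) 1)
    (Fin.cons (Pi.single (σ j) 1) v : Fin (q + 1) → Fin (q + 2) → k) :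
      Fin (q + 2) → Fin (q + 2) → k))
  have hmat : (Matrix.of (Fin.cons (Pi.single (σ i) 1)
      (Fin.cons (Pi.single (σ j) 1) v : Fin (q + 1) → Fin (q + 2) → k) :
        Fin (q + 2) → Fin (q + 2) → k)).submatrix id σ =
      Matrix.of (Fin.cons (Pi.single i 1) (Fin.cons (Pi.single j 1) (fun a b => v a (σ b)) :
        Fin (q + 1) → Fin (q + 2) → k) : Fin (q + 2) → Fin (q + 2) → k) := by
    ext a b
    refine Fin.cases ?_ (fun a => Fin.cases ?_ (fun a => ?_) a) a <;>
      simp [Pi.single_apply]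
  rw [hmat, h1, h2] at h3
  have hs : ((-1 : k) ^ ((i : ℕ) + j + 1)) * (-1) ^ ((i : ℕ) + j + 1) = 1 := by
    rw [← mul_pow]; simp
  have h4 := congrArg (fun t => (-1 : k) ^ ((i : ℕ) + j + 1) * t) h3
  simp only [← mul_assoc, hs, one_mul] at h4
  rw [h4, show (i : ℕ) + j + σ i + σ j = (i + j) + (σ i + σ j) by ring]
  simp only [pow_add, pow_one]
  ring

end Determinants

section Coordinates

variable {k}

lemma coordF_ιMulti {n q : ℕ} (idx : Fin q → Fin n) (v : Fin q → Fin n → k) :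
    coordF k q idx (ιMulti k q v) = Matrix.det (Matrix.of fun a b => v a (idx b)) := by
  rw [coordF, liftAlternating_apply_ιMulti, Function.update_self]
  rfl

lemma coordF_ιMulti_of_ne {n q r : ℕ} (h : r ≠ q) (idx : Fin q → Fin n) (v : Fin r → Fin n → k) :
    coordF k q idx (ιMulti k r v) = 0 := by
  rw [coordF, liftAlternating_apply_ιMulti, Function.update_of_ne h]
  rfl

lemma linearMap_ext_ιMulti {n q : ℕ} {f g : ExteriorAlgebra k (Fin n → k) →ₗ[k] k}
    (hf : ∀ r, r ≠ q → ∀ v : Fin r → Fin n → k, f (ιMulti k r v) = 0)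
    (hg : ∀ r, r ≠ q → ∀ v : Fin r → Fin n → k, g (ιMulti k r v) = 0)
    (h : ∀ v : Fin q → Fin n → k, f (ιMulti k q v) = g (ιMulti k q v)) : f = g := by
  refine lhom_ext fun r => AlternatingMap.ext fun v => ?_
  by_cases hr : r = q
  · subst hr
    exact h v
  · exact (hf r hr v).trans (hg r hr v).symm

lemma coordF_skipPair_perm {q : ℕ} (σ : Equiv.Perm (Fin (q + 2))) (i j : Fin (q + 2)) (h : i < j)
    (hσ : σ i < σ j) (ω : ExteriorAlgebra k (Fin (q + 2) → k)) :
    coordF k q (fun b => σ (skipPair i j h b)) ω =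
      (Equiv.Perm.sign σ : ℤ) * (-1) ^ ((i : ℕ) + j + σ i + σ j) *
        coordF k q (skipPair (σ i) (σ j) hσ) ω := by
  have key : coordF k q (fun b => σ (skipPair i j h b)) =
      (((Equiv.Perm.sign σ : ℤ) : k) * (-1) ^ ((i : ℕ) + j + σ i + σ j)) •
        coordF k q (skipPair (σ i) (σ j) hσ) := by
    refine linearMap_ext_ιMulti (q := q) (fun r hr v => coordF_ιMulti_of_ne hr _ v)
      (fun r hr v => ?_) (fun v => ?_)
    · rw [LinearMap.smul_apply, coordF_ιMulti_of_ne hr, smul_zero]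
    · rw [LinearMap.smul_apply, coordF_ιMulti, coordF_ιMulti, smul_eq_mul]
      exact det_skipPair_perm σ i j h hσ v
  rw [key, LinearMap.smul_apply, smul_eq_mul]

lemma det_sum_choices {m c : ℕ} (u : Fin (2 + (m + c)) → Fin 2 → k)
    (w : Fin (2 + (m + c)) → Fin m → Fin 2 → k) (z : Fin (2 + (m + c)) → Fin c → k) :
    ∑ ε : Fin m → Fin 2, Matrix.det (Matrix.of fun a =>
        Fin.append (u a) (Fin.append (fun l => w a l (ε l)) (z a))) =
      Matrix.det (Matrix.of fun a =>
        Fin.append (u a) (Fin.append (fun l => w a l 0 + w a l 1) (z a))) := by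
  simp only [Matrix.det_apply, Matrix.of_apply]
  rw [Finset.sum_comm]
  refine Finset.sum_congr rfl fun σ _ => ?_
  rw [← Finset.smul_sum]
  congr 1
  simp only [Fin.prod_univ_add, Fin.append_left, Fin.append_right]
  rw [← Finset.mul_sum, ← Finset.sum_mul]
  congr 2
  simp only [← Fin.sum_univ_two, Finset.prod_univ_sum, Fintype.piFinset_univ]

end Coordinates

/-- The index tuple `(α_1, …, α_4, β_1^1, …, β_m^1, γ_1, …, γ_c)` enumerating `S'`. -/
def fullTuple {n : ℕ} (m c : ℕ) (α : Fin 4 → Fin n) (β : Fin m → Fin 2 → Fin n)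
    (γ : Fin c → Fin n) (x : Fin (2 + (m + c) + 2)) : Fin n :=
  if h : (x : ℕ) < 4 then α ⟨x, h⟩
  else (Fin.append (fun l => β l 1) γ : Fin (m + c) → Fin n) ⟨x - 4, by omega⟩

/-- The position of `α i` in `fullTuple`. -/
def alphaIndex (m c : ℕ) (i : Fin 4) : Fin (2 + (m + c) + 2) :=
  ⟨i, by omega⟩

section Triple

variable {k} {n m c : ℕ} {α : Fin 4 → Fin n} {β : Fin m → Fin 2 → Fin n} {γ : Fin c → Fin n}

lemma OrderedABC.beta_ne_alpha (hord : OrderedABC m c α β γ) (l : Fin m) (e : Fin 2) (i : Fin 4) :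
    β l e ≠ α i := hord.1.ne (a₁ := Sum.inr (Sum.inl (l, e))) (a₂ := Sum.inl i) (by simp)

lemma OrderedABC.gamma_ne_alpha (hord : OrderedABC m c α β γ) (l : Fin c) (i : Fin 4) :
    γ l ≠ α i := hord.1.ne (a₁ := Sum.inr (Sum.inr l)) (a₂ := Sum.inl i) (by simp)

lemma OrderedABC.beta_ne_gamma (hord : OrderedABC m c α β γ) (l : Fin m) (e : Fin 2)
    (j : Fin c) : β l e ≠ γ j :=
  hord.1.ne (a₁ := Sum.inr (Sum.inl (l, e))) (a₂ := Sum.inr (Sum.inr j)) (by simp)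

lemma fullTuple_alphaIndex (i : Fin 4) :
    fullTuple m c α β γ (alphaIndex m c i) = α i := by
  simp [fullTuple, alphaIndex]

lemma fullTuple_injective (hord : OrderedABC m c α β γ) :
    Function.Injective (fullTuple m c α β γ) := by
  have hα : ∀ (i : Fin 4) (y : Fin (m + c)),
      α i ≠ (Fin.append (fun l => β l 1) γ : Fin (m + c) → Fin n) y := by
    intro i y
    refine Fin.addCases (fun l => ?_) (fun l => ?_) y
    · rw [Fin.append_left]
      exact (hord.beta_ne_alpha l 1 i).symm
    · rw [Fin.append_right]
      exact (hord.gamma_ne_alpha l i).symm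
  have happ : Function.Injective (Fin.append (fun l => β l 1) γ : Fin (m + c) → Fin n) := by
    refine Fin.append_injective_iff.2 ⟨(hord.2.2.2.1 1).injective,
      hord.2.2.2.2.2.2.injective, fun l j =>
        hord.beta_ne_gamma l 1 j⟩
  intro x y hxy
  unfold fullTuple at hxy
  split_ifs at hxy with hx hy hy
  · have := congrArg Fin.val (hord.2.1.injective hxy)
    exact Fin.ext this
  · exact absurd hxy (hα _ _)
  · exact absurd hxy.symm (hα _ _)
  · have := congrArg Fin.val (happ hxy)
    simp only at this
    omega

lemma fullTuple_mem_SP (x : Fin (2 + (m + c) + 2)) :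
    fullTuple m c α β γ x ∈ SP m c α β γ := by
  unfold fullTuple SP
  split_ifs with h
  · simp
  · generalize (⟨x - 4, _⟩ : Fin (m + c)) = y
    refine Fin.addCases (fun l => ?_) (fun l => ?_) y <;> simp

lemma mem_SP_iff {i : Fin n} :
    i ∈ SP m c α β γ ↔ ∃ x, fullTuple m c α β γ x = i := by
  refine ⟨fun h => ?_, ?_⟩
  · simp only [SP, Finset.mem_union, Finset.mem_image, Finset.mem_univ, true_and] at h
    rcases h with (⟨j, rfl⟩ | ⟨l, rfl⟩) | ⟨l, rfl⟩
    · exact ⟨alphaIndex m c j, fullTuple_alphaIndex j⟩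
    · exact ⟨⟨l + 4, by omega⟩, 
        (dif_neg (by simp)).trans (Fin.append_left (fun l => β l 1) γ l)⟩
    · exact ⟨⟨m + l + 4, by omega⟩, 
        (dif_neg (by simp)).trans (Fin.append_right (fun l => β l 1) γ l)⟩
  · rintro ⟨x, rfl⟩
    exact fullTuple_mem_SP x

lemma card_SP (hord : OrderedABC m c α β γ) :
    (SP m c α β γ).card = 2 + (m + c) + 2 := by
  have : SP m c α β γ = Finset.univ.image (fullTuple m c α β γ) := by
    ext i
    simp [mem_SP_iff]
  rw [this, Finset.card_image_of_injective _ (fullTuple_injective hord), Finset.card_univ,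
    Fintype.card_fin]

/-- The permutation sending a position in `fullTuple` to the position of the same index in the
sorted enumeration of `S'`. -/
def sortPerm (hord : OrderedABC m c α β γ) : Equiv.Perm (Fin (2 + (m + c) + 2)) :=
  Equiv.ofBijective
    (fun x => ((SP m c α β γ).orderIsoOfFin (card_SP hord)).symm ⟨_, fullTuple_mem_SP x⟩)
    (Finite.injective_iff_bijective.1 fun x y h => fullTuple_injective hord (by simpa using h))

lemma orderIsoOfFin_sortPerm (hord : OrderedABC m c α β γ) (x : Fin (2 + (m + c) + 2)) :
    ((SP m c α β γ).orderIsoOfFin (card_SP hord) (sortPerm hord x) : Fin n) =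
      fullTuple m c α β γ x := by
  simp [sortPerm]

lemma sortPerm_alphaIndex_lt (hord : OrderedABC m c α β γ) {i j : Fin 4} (h : i < j) :
    sortPerm hord (alphaIndex m c i) < sortPerm hord (alphaIndex m c j) := by
  rw [← ((SP m c α β γ).orderIsoOfFin (card_SP hord)).lt_iff_lt, ← Subtype.coe_lt_coe,
    orderIsoOfFin_sortPerm, orderIsoOfFin_sortPerm, fullTuple_alphaIndex, fullTuple_alphaIndex]
  exact hord.2.1 h

lemma XL_apply_sortPerm (hord : OrderedABC m c α β γ) (v : Fin n → k)
    (x : Fin (2 + (m + c) + 2)) :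
    XL k (2 + (m + c)) m c α β γ v (sortPerm hord x) =
      v (fullTuple m c α β γ x) +
        ∑ l, if β l 1 = fullTuple m c α β γ x then v (β l 0) else 0 := by
  have hX : ∀ i, Xmat k (2 + (m + c)) m c α β γ (sortPerm hord x) i =
      (if i = fullTuple m c α β γ x then 1 else 0) +
        ∑ l, if i = β l 0 ∧ β l 1 = fullTuple m c α β γ x then 1 else 0 := by
    intro i
    have hX' : Xmat k (2 + (m + c)) m c α β γ = fun j i => _ := dif_pos (card_SP hord)
    convert congrFun (congrFun hX' (sortPerm hord x)) i <;>
      exact (orderIsoOfFin_sortPerm hord x).symm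
  simp only [XL, hX, Matrix.mulVecLin_apply, Matrix.mulVec, dotProduct, add_mul, Finset.sum_add_distrib, Finset.sum_mul]
  congr 1
  · simp
  · rw [Finset.sum_comm]
    refine Finset.sum_congr rfl fun l _ => ?_
    simp [ite_and]

lemma XL_single_alpha (hord : OrderedABC m c α β γ) (i : Fin 4) :
    XL k (2 + (m + c)) m c α β γ (Pi.single (α i) 1) =
      Pi.single (sortPerm hord (alphaIndex m c i)) 1 := by
  funext y
  obtain ⟨x, rfl⟩ := (sortPerm hord).surjective y
  rw [XL_apply_sortPerm, Finset.sum_eq_zero, add_zero]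
  · rw [← fullTuple_alphaIndex (m := m) (c := c) (α := α) (β := β) (γ := γ) i]
    simp [Pi.single_apply, (fullTuple_injective hord).eq_iff]
  · intro l _
    simp [hord.beta_ne_alpha l 0 i]

lemma ZL_single (hord : OrderedABC m c α β γ) (x : Fin (2 + (m + c) + 2)) (i : Fin 4) :
    ZL k (2 + (m + c)) m c α β γ (Pi.single x 1) i =
      if x = sortPerm hord (alphaIndex m c i) then 1 else 0 := by
  simp only [ZL, Matrix.mulVecLin_apply, Matrix.mulVec_single_one, Matrix.col_apply, Zmat]
  by_cases hx : x = sortPerm hord (alphaIndex m c i)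
  · rw [if_pos hx, hx, if_pos (XL_single_alpha hord i)]
  rw [if_neg hx, if_neg]
  intro h
  have := congrFun h x
  rw [XL_single_alpha hord, Pi.single_eq_same, Pi.single_eq_of_ne hx] at this
  exact zero_ne_one this

lemma piF_eq_coordF_map (hord : OrderedABC m c α β γ) (i j : Fin 4)
    (g : Fin (2 + (m + c)) → Fin (2 + (m + c) + 2))
    (hg : ∀ b, fullTuple m c α β γ (g b) = tupleP m c α β γ i j (fun _ => 1) b)
    (ω : ExteriorAlgebra k (Fin n → k)) :
    piF k m c α β γ i j ω =
      coordF k (2 + (m + c)) (fun b => sortPerm hord (g b))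
        (ExteriorAlgebra.map (XL k (2 + (m + c)) m c α β γ) ω) := by
  suffices h : piF k m c α β γ i j = (coordF k (2 + (m + c)) (fun b => sortPerm hord (g b))).comp
      (ExteriorAlgebra.map (XL k (2 + (m + c)) m c α β γ)).toLinearMap by
    rw [h]
    rfl
  refine linearMap_ext_ιMulti (q := 2 + (m + c)) (fun r hr v => ?_) (fun r hr v => ?_)
    (fun v => ?_)
  · simp [piF, LinearMap.sum_apply, coordF_ιMulti_of_ne hr]
  · simp [map_apply_ιMulti, coordF_ιMulti_of_ne hr]
  · simp only [piF, LinearMap.sum_apply, LinearMap.comp_apply, AlgHom.toLinearMap_apply,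
      map_apply_ιMulti, coordF_ιMulti, Function.comp_apply, XL_apply_sortPerm, hg]
    have hα : ∀ l a, β l 1 ≠ (![α i, α j] : Fin 2 → Fin n) a := by
      intro l a
      fin_cases a
      · exact hord.beta_ne_alpha l 1 i
      · exact hord.beta_ne_alpha l 1 j
    have hγ := fun l => hord.beta_ne_gamma l 1
    have hβ : ∀ l l', β l 1 = β l' 1 ↔ l = l' := fun l l' =>
      (hord.2.2.2.1 1).injective.eq_iff
    convert det_sum_choices (fun a b => v a ((![α i, α j] : Fin 2 → Fin n) b))
      (fun a l e => v a (β l e)) (fun a b => v a (γ b)) using 2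
    · congr 1
      ext a b
      refine Fin.addCases (fun b => ?_) (Fin.addCases (fun b => ?_) (fun b => ?_)) b <;>
        simp [tupleP]
    · ext a b
      refine Fin.addCases (fun b => ?_) (Fin.addCases (fun b => ?_) (fun b => ?_)) b <;>
        simp [tupleP, hα, hβ, hγ, add_comm]

lemma ite_mul_ite_sub_ite_mul_ite {N : ℕ} {s : Finset (Fin N)} {x y a b : Fin N} (hs : s = {x, y})
    (hxy : x < y) (hab : a < b) :
    ((if x = a then 1 else 0) * (if y = b then 1 else 0) -
      (if x = b then 1 else 0) * (if y = a then 1 else 0) : k) =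
      if s = {a, b} then 1 else 0 := by
  subst hs
  have hiff : ({x, y} : Finset (Fin N)) = {a, b} ↔ x = a ∧ y = b := by
    rw [← Finset.coe_inj, Finset.coe_pair, Finset.coe_pair, Set.pair_eq_pair_iff]
    refine ⟨fun h => h.resolve_right fun h => ?_, Or.inl⟩
    exact absurd hab (h.1 ▸ h.2 ▸ hxy).not_gt
  have hno : ¬ (x = b ∧ y = a) := fun h => absurd hab (h.1 ▸ h.2 ▸ hxy).not_gt
  simp only [hiff, ite_zero_mul_ite_zero, mul_one, if_neg hno, sub_zero]

lemma coordF_two_ιMulti_map_ZL (hord : OrderedABC m c α β γ) {i j : Fin 4} (h : i < j) {q : ℕ}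
    (hq : q = 2) {s : Finset (Fin (2 + (m + c) + 2))} (hs : s.card = q) :
    coordF k 2 ![i, j] (ιMulti k q (ZL k (2 + (m + c)) m c α β γ ∘
        fun a => Pi.single (s.orderIsoOfFin hs a : Fin (2 + (m + c) + 2)) (1 : k))) =
      if s = {sortPerm hord (alphaIndex m c i), sortPerm hord (alphaIndex m c j)}
        then 1 else 0 := by
  subst hq
  have hlt := sortPerm_alphaIndex_lt hord h
  have hZ := ZL_single (k := k) hord
  have h01 : (s.orderIsoOfFin hs 0 : Fin (2 + (m + c) + 2)) < s.orderIsoOfFin hs 1 :=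
    (s.orderIsoOfFin hs).strictMono (by decide)
  have hs' : s = {(s.orderIsoOfFin hs 0 : Fin (2 + (m + c) + 2)),
      (s.orderIsoOfFin hs 1 : Fin (2 + (m + c) + 2))} := by
    refine (Finset.eq_of_subset_of_card_le ?_ ?_).symm
    · intro x hx
      rcases Finset.mem_insert.1 hx with rfl | hx
      · exact Subtype.coe_prop _
      · rw [Finset.mem_singleton.1 hx]
        exact Subtype.coe_prop _
    · rw [hs, Finset.card_pair h01.ne]
  rw [coordF_ιMulti, Matrix.det_fin_two]
  simp only [Matrix.of_apply, Function.comp_apply, hZ, Matrix.cons_val_zero, Matrix.cons_val_one]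
  clear hZ
  exact ite_mul_ite_sub_ite_mul_ite hs' h01 hlt

lemma coordF_two_GABC (hord : OrderedABC m c α β γ) {i j : Fin 4} (h : i < j)
    (ω : ExteriorAlgebra k (Fin n → k)) :
    coordF k 2 ![i, j] (GABC k (2 + (m + c)) m c α β γ ω) =
      coordF k (2 + (m + c))
        (skipPair (sortPerm hord (alphaIndex m c i)) (sortPerm hord (alphaIndex m c j))
          (sortPerm_alphaIndex_lt hord h))
        (ExteriorAlgebra.map (XL k (2 + (m + c)) m c α β γ) ω) := by
  have hlt := sortPerm_alphaIndex_lt hord h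
  simp only [GABC, dualAt, map_sum, map_smul, map_apply_ιMulti,
    coordF_two_ιMulti_map_ZL hord h (by omega : 2 + (m + c) + 2 - (2 + (m + c)) = 2)]
  have hcard : ({sortPerm hord (alphaIndex m c i), sortPerm hord (alphaIndex m c j)}ᶜ :
      Finset (Fin (2 + (m + c) + 2))).card = 2 + (m + c) := by
    rw [Finset.card_compl, Finset.card_pair hlt.ne, Fintype.card_fin]
    omega
  rw [Finset.sum_eq_single ⟨_, hcard⟩]
  · rw [compl_compl, if_pos rfl, smul_eq_mul, mul_one]
    congr 1
    refine congrArg _ (Finset.orderEmbOfFin_unique hcard (fun x => ?_)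
      (skipPair_strictMono _ _ hlt)).symm
    simp [skipPair_ne_left, skipPair_ne_right]
  · intro s _ hs
    rw [if_neg, smul_zero]
    intro hs'
    exact hs (Subtype.ext (compl_eq_comm.1 hs').symm)
  · simp

lemma piF_eq_sign_mul_coordF_GABC (hord : OrderedABC m c α β γ) {i j : Fin 4} (h : i < j)
    (i' j' : Fin 4)
    (hij : ∀ x : Fin 2, ((![i', j'] x : Fin 4) : ℕ) =
      if (x : ℕ) < i then (x : ℕ) else if (x : ℕ) + 1 < j then x + 1 else x + 2)
    (ω : ExteriorAlgebra k (Fin n → k)) :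
    piF k m c α β γ i' j' ω =
      (Equiv.Perm.sign (sortPerm hord) : ℤ) *
        (-1) ^ ((i : ℕ) + j + sortPerm hord (alphaIndex m c i) +
          sortPerm hord (alphaIndex m c j)) *
        coordF k 2 ![i, j] (GABC k (2 + (m + c)) m c α β γ ω) := by
  have hlt : alphaIndex m c i < alphaIndex m c j := h
  have hlt' : (i : ℕ) < j := h
  rw [coordF_two_GABC hord h, piF_eq_coordF_map hord i' j' (skipPair _ _ hlt),
    coordF_skipPair_perm (sortPerm hord) _ _ hlt (sortPerm_alphaIndex_lt hord h)]
  · rfl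
  · intro b
    unfold tupleP
    refine Fin.addCases (fun b => ?_) (fun b => ?_) b
    · rw [Fin.append_left, show (![α i', α j'] : Fin 2 → Fin n) b = α (![i', j'] b) by
        fin_cases b <;> rfl, ← fullTuple_alphaIndex (m := m) (c := c) (α := α) (β := β) (γ := γ)]
      congr 1
      rw [Fin.ext_iff, skipPair_val]
      exact (hij b).symm
    · have hv : (skipPair (alphaIndex m c i) (alphaIndex m c j) hlt (Fin.natAdd 2 b) : ℕ) =
          b + 4 := by
        rw [skipPair_val]
        have hi : (alphaIndex m c i : ℕ) = i := rfl
        have hj : (alphaIndex m c j : ℕ) = j := rfl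
        rw [hi, hj, Fin.val_natAdd]
        split_ifs <;> omega
      rw [Fin.append_right]
      simp [fullTuple, hv]

end Triple

/-- For an ordered triple `(A,B,C)`, the quadratic form `P'_{A,B,C}` is,
up to a sign `ε = ±1`, the pullback under `G_{A,B,C}` of the single Plücker relation on
`⋀² k⁴`. -/
theorem Pprime_eq_pullback_of_GABC
    {k : Type*} [Field k] {p n : ℕ} (m c : ℕ)
    (α : Fin 4 → Fin n) (β : Fin m → Fin 2 → Fin n) (γ : Fin c → Fin n)
    (hmc : 2 + (m + c) = p) (hord : OrderedABC m c α β γ) :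
    ∃ ε : k, (ε = 1 ∨ ε = -1) ∧
      ∀ ω : ⋀[k]^p (Fin n → k),
        Pprime k m c α β γ ω.val =
          ε * (coordF k 2 ![0, 1] (GABC k p m c α β γ ω.val)
                 * coordF k 2 ![2, 3] (GABC k p m c α β γ ω.val)
               - coordF k 2 ![0, 2] (GABC k p m c α β γ ω.val)
                 * coordF k 2 ![1, 3] (GABC k p m c α β γ ω.val)
               + coordF k 2 ![0, 3] (GABC k p m c α β γ ω.val)
                 * coordF k 2 ![1, 2] (GABC k p m c α β γ ω.val)) := by
  subst hmc
  let f : Fin 4 → ℕ := fun i => sortPerm hord (alphaIndex m c i)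
  let s : k := ((Equiv.Perm.sign (sortPerm hord) : ℤ) : k)
  have hs : s * s = 1 := by
    rcases Int.units_eq_one_or (Equiv.Perm.sign (sortPerm hord)) with h | h <;> simp [s, h]
  refine ⟨(-1) ^ (f 0 + f 1 + f 2 + f 3), neg_one_pow_eq_or k _, fun ω => ?_⟩
  have h01 := piF_eq_sign_mul_coordF_GABC (k := k) hord (i := 2) (j := 3) (by decide) 0 1
    (by decide) ω.val
  have h23 := piF_eq_sign_mul_coordF_GABC (k := k) hord (i := 0) (j := 1) (by decide) 2 3
    (by decide) ω.val
  have h02 := piF_eq_sign_mul_coordF_GABC (k := k) hord (i := 1) (j := 3) (by decide) 0 2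
    (by decide) ω.val
  have h13 := piF_eq_sign_mul_coordF_GABC (k := k) hord (i := 0) (j := 2) (by decide) 1 3
    (by decide) ω.val
  have h03 := piF_eq_sign_mul_coordF_GABC (k := k) hord (i := 1) (j := 2) (by decide) 0 3
    (by decide) ω.val
  have h12 := piF_eq_sign_mul_coordF_GABC (k := k) hord (i := 0) (j := 3) (by decide) 1 2
    (by decide) ω.val
  have hsign : ∀ (a b d e : Fin 4) (x y : k), (a : ℕ) + b + d + e = 6 →
      f a + f b + f d + f e = f 0 + f 1 + f 2 + f 3 →
      s * (-1) ^ ((a : ℕ) + b + f a + f b) * x * (s * (-1) ^ ((d : ℕ) + e + f d + f e) * y) =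
        (-1) ^ (f 0 + f 1 + f 2 + f 3) * (x * y) := by
    intro a b d e x y h6 hf
    have hpow : (-1 : k) ^ ((a : ℕ) + b + f a + f b) * (-1) ^ ((d : ℕ) + e + f d + f e) =
        (-1) ^ (f 0 + f 1 + f 2 + f 3) := by
      rw [← pow_add, show (a : ℕ) + b + f a + f b + (d + e + f d + f e) =
        6 + (f 0 + f 1 + f 2 + f 3) by omega, pow_add]
      norm_num
    rw [← hpow]
    linear_combination (-1 : k) ^ ((a : ℕ) + b + f a + f b) *
      (-1) ^ ((d : ℕ) + e + f d + f e) * x * y * hs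
  rw [Pprime, h01, h23, h02, h13, h03, h12]
  have e1 := hsign 2 3 0 1 (coordF k 2 ![2, 3] (GABC k (2 + (m + c)) m c α β γ ω.val))
    (coordF k 2 ![0, 1] (GABC k (2 + (m + c)) m c α β γ ω.val)) rfl (by ring)
  have e2 := hsign 1 3 0 2 (coordF k 2 ![1, 3] (GABC k (2 + (m + c)) m c α β γ ω.val))
    (coordF k 2 ![0, 2] (GABC k (2 + (m + c)) m c α β γ ω.val)) rfl (by ring)
  have e3 := hsign 1 2 0 3 (coordF k 2 ![1, 2] (GABC k (2 + (m + c)) m c α β γ ω.val))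
    (coordF k 2 ![0, 3] (GABC k (2 + (m + c)) m c α β γ ω.val)) rfl (by ring)
  linear_combination e1 - e2 + e3

end
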